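/- Let (X,d,f) be an irreducible Smale space such that every local stable set X^s(x,ε) with 0 < ε ≤ ε_X is totally disconnected. Then there exist a compact metric space (Y,δ), a continuous surjection α : Y → Y, and constants β > 0, integer K ≥ 1, 0 < γ < 1 such that (Y, δ, α) satisfies Axioms 1 and 2, and (X,d,f) is topologically conjugate to the stationary inverse limit (Ŷ, δ̂, α̂): there is a homeomorphism h : X → Ŷ with h ∘ f = α̂ ∘ h. -/

import Mathlib

open Metric Function Topology

variable {X : Type*} [MetricSpace X] [CompactSpace X]

/-- The local stable set `X^s(x, ε)` of the homeomorphism `f`. -/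
def stab (f : X ≃ₜ X) (x : X) (ε : ℝ) : Set X :=
  {y | ∀ n : ℕ, dist ((⇑f)^[n] x) ((⇑f)^[n] y) ≤ ε}

/-- The local unstable set `X^u(x, ε)` of the homeomorphism `f`. -/
def unstab (f : X ≃ₜ X) (x : X) (ε : ℝ) : Set X :=
  {y | ∀ n : ℕ, dist ((⇑f.symm)^[n] x) ((⇑f.symm)^[n] y) ≤ ε}

/-- `(X, d, f)` is a Smale space with constants `εX, εX', lam`. -/
def isSmale (f : X ≃ₜ X) (εX εX' lam : ℝ) : Prop :=
  0 < εX ∧ 0 < εX' ∧ 0 < lam ∧ lam < 1 ∧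
  (∀ (x y z : X) (n : ℕ), y ∈ stab f x εX' → z ∈ stab f x εX' →
      dist ((⇑f)^[n] y) ((⇑f)^[n] z) ≤ lam ^ n * dist y z) ∧
  (∀ (x y z : X) (n : ℕ), y ∈ unstab f x εX' → z ∈ unstab f x εX' →
      dist ((⇑f.symm)^[n] y) ((⇑f.symm)^[n] z) ≤ lam ^ n * dist y z) ∧
  (∀ x y : X, dist x y ≤ εX → ∃! z : X, z ∈ stab f x εX' ∩ unstab f y εX')

/-- Axiom 1 for a continuous surjection of a metric space. -/
def axiom1 {Y : Type*} [MetricSpace Y] (α : Y → Y) (β : ℝ) (K : ℕ) (γ : ℝ) : Prop :=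
  ∀ x y : Y, dist x y ≤ β →
    dist (α^[K] x) (α^[K] y) ≤ γ ^ K * dist (α^[2 * K] x) (α^[2 * K] y)

/-- Axiom 2 for a continuous surjection of a metric space. -/
def axiom2 {Y : Type*} [MetricSpace Y] (α : Y → Y) (β : ℝ) (K : ℕ) (γ : ℝ) : Prop :=
  ∀ x : Y, ∀ ε : ℝ, 0 < ε → ε ≤ β →
    α^[K] '' Metric.closedBall (α^[K] x) ε ⊆ α^[2 * K] '' Metric.closedBall x (γ * ε)

/-- The stationary inverse limit of `α : Y → Y`. -/
abbrev InvLim {Y : Type*} (α : Y → Y) : Type _ :=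
  {y : ℕ → Y // ∀ n : ℕ, y n = α (y (n + 1))}

/-- The induced map `α̂` on the inverse limit. -/
def ghat {Y : Type*} (α : Y → Y) (y : InvLim α) : InvLim α :=
  ⟨fun n => α (y.1 n), fun n => congrArg α (y.2 n)⟩

universe u

/-- `(X, f)` is conjugate to the stationary inverse limit of `(Y, α)`, where `(Y, α)`
is a compact metric space with a continuous surjection satisfying Axioms 1 and 2. -/
def conjToInvLim (X : Type u) [MetricSpace X] (f : X ≃ₜ X)
    (Y : Type u) [MetricSpace Y] (α : Y → Y) : Prop :=
  CompactSpace Y ∧ Continuous α ∧ Function.Surjective α ∧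
  ∃ (β γ : ℝ) (K : ℕ), 0 < β ∧ 1 ≤ K ∧ 0 < γ ∧ γ < 1 ∧
    axiom1 α β K γ ∧ axiom2 α β K γ ∧
    ∃ h : X → InvLim α, IsHomeomorph h ∧ ∀ x : X, h (f x) = ghat α (h x)

set_option linter.unusedSectionVars false

namespace Wieler

theorem stab_self (f : X ≃ₜ X) (x : X) {a : ℝ} (ha : 0 ≤ a) : x ∈ stab f x a := by
  intro n; simpa using ha

theorem stab_symm {f : X ≃ₜ X} {x y : X} {a : ℝ} (h : y ∈ stab f x a) : x ∈ stab f y a := by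
  intro n; rw [dist_comm]; exact h n

theorem stab_trans {f : X ≃ₜ X} {x y z : X} {a b : ℝ} (h : y ∈ stab f x a)
    (h' : z ∈ stab f y b) : z ∈ stab f x (a + b) := by
  intro n
  exact (dist_triangle _ _ _).trans (add_le_add (h n) (h' n))

theorem stab_mono {f : X ≃ₜ X} {x y : X} {a b : ℝ} (h : y ∈ stab f x a) (hab : a ≤ b) :
    y ∈ stab f x b := fun n => (h n).trans hab

theorem unstab_eq (f : X ≃ₜ X) (x : X) (a : ℝ) : unstab f x a = stab f.symm x a := rfl

theorem unstab_symm {f : X ≃ₜ X} {x y : X} {a : ℝ} (h : y ∈ unstab f x a) :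
    x ∈ unstab f y a := stab_symm (f := f.symm) h

theorem unstab_trans {f : X ≃ₜ X} {x y z : X} {a b : ℝ} (h : y ∈ unstab f x a)
    (h' : z ∈ unstab f y b) : z ∈ unstab f x (a + b) := stab_trans (f := f.symm) h h'

theorem unstab_mono {f : X ≃ₜ X} {x y : X} {a b : ℝ} (h : y ∈ unstab f x a) (hab : a ≤ b) :
    y ∈ unstab f x b := fun n => (h n).trans hab

theorem stab_dist {f : X ≃ₜ X} {x y : X} {a : ℝ} (h : y ∈ stab f x a) : dist x y ≤ a := h 0

theorem unstab_dist {f : X ≃ₜ X} {x y : X} {a : ℝ} (h : y ∈ unstab f x a) : dist x y ≤ a := h 0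

theorem isClosed_stab (f : X ≃ₜ X) (a : ℝ) : IsClosed {p : X × X | p.2 ∈ stab f p.1 a} := by
  have : {p : X × X | p.2 ∈ stab f p.1 a} =
      ⋂ n : ℕ, {p : X × X | dist ((⇑f)^[n] p.1) ((⇑f)^[n] p.2) ≤ a} := by
    ext p; simp [stab]
  rw [this]
  refine isClosed_iInter fun n => ?_
  have := f.continuous.iterate n
  exact isClosed_le (by fun_prop) continuous_const

theorem isClosed_unstab (f : X ≃ₜ X) (a : ℝ) : IsClosed {p : X × X | p.2 ∈ unstab f p.1 a} :=
  isClosed_stab f.symm a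

section
variable {f : X ≃ₜ X} {e e' lam : ℝ}

theorem contr_s (hS : isSmale f e e' lam) {x y : X} (h : y ∈ stab f x e') (n : ℕ) :
    dist ((⇑f)^[n] x) ((⇑f)^[n] y) ≤ lam ^ n * dist x y :=
  hS.2.2.2.2.1 x x y n (stab_self f x hS.2.1.le) h

theorem contr_u (hS : isSmale f e e' lam) {x y : X} (h : y ∈ unstab f x e') (n : ℕ) :
    dist ((⇑f.symm)^[n] x) ((⇑f.symm)^[n] y) ≤ lam ^ n * dist x y :=
  hS.2.2.2.2.2.1 x x y n (stab_self f.symm x hS.2.1.le) h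

theorem stab_small (hS : isSmale f e e' lam) {x y : X} (h : y ∈ stab f x e') {a : ℝ}
    (ha : dist x y ≤ a) : y ∈ stab f x a := fun n =>
  (contr_s hS h n).trans ((mul_le_of_le_one_left dist_nonneg
    (pow_le_one₀ hS.2.2.1.le hS.2.2.2.1.le)).trans ha)

theorem unstab_small (hS : isSmale f e e' lam) {x y : X} (h : y ∈ unstab f x e') {a : ℝ}
    (ha : dist x y ≤ a) : y ∈ unstab f x a := fun n =>
  (contr_u hS h n).trans ((mul_le_of_le_one_left dist_nonneg
    (pow_le_one₀ hS.2.2.1.le hS.2.2.2.1.le)).trans ha)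

theorem uniq (hS : isSmale f e e' lam) {x y : X} (h : y ∈ stab f x e')
    (h' : y ∈ unstab f x e') : y = x := by
  obtain ⟨z, hz, hu⟩ := hS.2.2.2.2.2.2 x x (by simpa using hS.1.le)
  rw [hu y ⟨h, h'⟩, hu x ⟨stab_self f x hS.2.1.le, stab_self f.symm x hS.2.1.le⟩]

theorem brkt (hS : isSmale f e e' lam) {ε : ℝ} (hε : 0 < ε) :
    ∃ δ > 0, ∀ x y : X, dist x y ≤ δ → ∃ z, z ∈ stab f x ε ∧ z ∈ unstab f y ε := by
  -- bad set
  let Z : Set (X × X × X) := {p | p.2.2 ∈ stab f p.1 e' ∧ p.2.2 ∈ unstab f p.2.1 e' ∧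
    (ε ≤ dist p.1 p.2.2 ∨ ε ≤ dist p.2.1 p.2.2)}
  have hZ : IsClosed Z := by
    have h1 : IsClosed {p : X × X × X | p.2.2 ∈ stab f p.1 e'} :=
      (isClosed_stab f e').preimage (f := fun p : X × X × X => (p.1, p.2.2)) (by fun_prop)
    have h2 : IsClosed {p : X × X × X | p.2.2 ∈ unstab f p.2.1 e'} :=
      (isClosed_unstab f e').preimage (f := fun p : X × X × X => (p.2.1, p.2.2)) (by fun_prop)
    have h3 : IsClosed {p : X × X × X | ε ≤ dist p.1 p.2.2} :=
      isClosed_le (by fun_prop) (by fun_prop)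
    have h4 : IsClosed {p : X × X × X | ε ≤ dist p.2.1 p.2.2} :=
      isClosed_le (by fun_prop) (by fun_prop)
    exact h1.inter (h2.inter (h3.union h4))
  have key : ∃ δ > 0, ∀ p ∈ Z, δ < dist p.1 p.2.1 := by
    rcases Z.eq_empty_or_nonempty with h | h
    · exact ⟨1, one_pos, by simp [h]⟩
    · obtain ⟨p, hp, hmin⟩ := hZ.isCompact.exists_isMinOn h
        (f := fun p : X × X × X => dist p.1 p.2.1) (by fun_prop)
      have hpos : 0 < dist p.1 p.2.1 := by
        rw [dist_pos]
        intro heq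
        obtain ⟨h1, h2, h3⟩ := hp
        rw [← heq] at h2 h3
        have := uniq hS h1 h2
        rw [this] at h3
        simp at h3
        linarith
      refine ⟨dist p.1 p.2.1 / 2, by linarith, fun q hq => ?_⟩
      have := hmin hq
      simp only [Set.mem_ofPred_eq] at this
      linarith
  obtain ⟨δ, hδ, hk⟩ := key
  refine ⟨min δ e, lt_min hδ hS.1, fun x y hxy => ?_⟩
  obtain ⟨z, ⟨hz1, hz2⟩, -⟩ := hS.2.2.2.2.2.2 x y (hxy.trans (min_le_right _ _))
  have hn : ¬ (ε ≤ dist x z ∨ ε ≤ dist y z) := by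
    intro h
    have := hk (x, y, z) ⟨hz1, hz2, h⟩
    have := hxy.trans (min_le_left _ _)
    simp only at *
    linarith
  push Not at hn
  exact ⟨z, stab_small hS hz1 hn.1.le, unstab_small hS hz2 hn.2.le⟩

/-- continuity of the stable coordinate -/
theorem s_cont (hS : isSmale f e e' lam) {a : ℝ} (ha : 2 * a ≤ e') (x0 : X) {τ : ℝ}
    (hτ : 0 < τ) :
    ∃ η > 0, ∀ x y s s' : X, dist x y ≤ η → s ∈ stab f x0 a → s' ∈ stab f x0 a →
      s ∈ unstab f x a → s' ∈ unstab f y a → dist s s' < τ := by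
  let Z : Set (X × X × X × X) := {p | p.2.2.1 ∈ stab f x0 a ∧ p.2.2.2 ∈ stab f x0 a ∧
    p.2.2.1 ∈ unstab f p.1 a ∧ p.2.2.2 ∈ unstab f p.2.1 a ∧ τ ≤ dist p.2.2.1 p.2.2.2}
  have hZ : IsClosed Z := by
    have h1 : IsClosed {p : X × X × X × X | p.2.2.1 ∈ stab f x0 a} :=
      (isClosed_stab f a).preimage (f := fun p : X × X × X × X => (x0, p.2.2.1)) (by fun_prop)
    have h2 : IsClosed {p : X × X × X × X | p.2.2.2 ∈ stab f x0 a} :=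
      (isClosed_stab f a).preimage (f := fun p : X × X × X × X => (x0, p.2.2.2)) (by fun_prop)
    have h3 : IsClosed {p : X × X × X × X | p.2.2.1 ∈ unstab f p.1 a} :=
      (isClosed_unstab f a).preimage (f := fun p : X × X × X × X => (p.1, p.2.2.1))
        (by fun_prop)
    have h4 : IsClosed {p : X × X × X × X | p.2.2.2 ∈ unstab f p.2.1 a} :=
      (isClosed_unstab f a).preimage (f := fun p : X × X × X × X => (p.2.1, p.2.2.2))
        (by fun_prop)
    have h5 : IsClosed {p : X × X × X × X | τ ≤ dist p.2.2.1 p.2.2.2} :=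
      isClosed_le (by fun_prop) (by fun_prop)
    exact h1.inter (h2.inter (h3.inter (h4.inter h5)))
  have key : ∃ δ > 0, ∀ p ∈ Z, δ < dist p.1 p.2.1 := by
    rcases Z.eq_empty_or_nonempty with h | h
    · exact ⟨1, one_pos, by simp [h]⟩
    · obtain ⟨p, hp, hmin⟩ := hZ.isCompact.exists_isMinOn h
        (f := fun p : X × X × X × X => dist p.1 p.2.1) (by fun_prop)
      have hpos : 0 < dist p.1 p.2.1 := by
        rw [dist_pos]
        intro heq
        obtain ⟨h1, h2, h3, h4, h5⟩ := hp
        rw [← heq] at h4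
        have := uniq hS (stab_mono (stab_trans (stab_symm h1) h2) (by linarith))
          (unstab_mono (unstab_trans (unstab_symm h3) h4) (by linarith))
        rw [this] at h5
        simp at h5
        linarith
      refine ⟨dist p.1 p.2.1 / 2, by linarith, fun q hq => ?_⟩
      have := hmin hq
      simp only [Set.mem_ofPred_eq] at this
      linarith
  obtain ⟨δ, hδ, hk⟩ := key
  refine ⟨δ, hδ, fun x y s s' hxy h1 h2 h3 h4 => ?_⟩
  by_contra hcon
  have := hk (x, y, s, s') ⟨h1, h2, h3, h4, not_lt.1 hcon⟩
  simp only at this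
  linarith

theorem symm_iter_sub (f : X ≃ₜ X) (x : X) {m n : ℕ} (h : m ≤ n) :
    (⇑f.symm)^[m] ((⇑f)^[n] x) = (⇑f)^[n - m] x := by
  obtain ⟨k, rfl⟩ := Nat.exists_eq_add_of_le h
  rw [Function.iterate_add_apply, Nat.add_sub_cancel_left]
  exact (f.left_inv.iterate m) _

theorem symm_iter_sub' (f : X ≃ₜ X) (x : X) {m n : ℕ} (h : n ≤ m) :
    (⇑f.symm)^[m] ((⇑f)^[n] x) = (⇑f.symm)^[m - n] x := by
  obtain ⟨k, rfl⟩ := Nat.exists_eq_add_of_le h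
  rw [Nat.add_comm n k, Function.iterate_add_apply, Nat.add_sub_cancel]
  congr 1
  exact (f.left_inv.iterate n) _

theorem unstab_shift {x y : X} {a : ℝ} {n : ℕ} (h : y ∈ unstab f x a)
    (hk : ∀ k ≤ n, dist ((⇑f)^[k] x) ((⇑f)^[k] y) ≤ a) :
    (⇑f)^[n] y ∈ unstab f ((⇑f)^[n] x) a := by
  intro m
  rcases le_total m n with hmn | hmn
  · rw [symm_iter_sub f x hmn, symm_iter_sub f y hmn]
    exact hk _ (Nat.sub_le _ _)
  · rw [symm_iter_sub' f x hmn, symm_iter_sub' f y hmn]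
    exact h _

theorem unstab_decay (hS : isSmale f e e' lam) {x y : X} {n : ℕ} (h : y ∈ unstab f x e')
    (hk : ∀ k ≤ n, dist ((⇑f)^[k] x) ((⇑f)^[k] y) ≤ e') {k : ℕ} (hkn : k ≤ n) :
    dist ((⇑f)^[k] x) ((⇑f)^[k] y) ≤ lam ^ (n - k) * e' := by
  have h1 := contr_u hS (unstab_shift h hk) (n - k)
  rw [symm_iter_sub f x (Nat.sub_le _ _), symm_iter_sub f y (Nat.sub_le _ _),
    Nat.sub_sub_self hkn] at h1
  exact h1.trans (mul_le_mul_of_nonneg_left (hk n le_rfl) (pow_nonneg hS.2.2.1.le _))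

theorem unstab_decay0 (hS : isSmale f e e' lam) {x y : X} {n : ℕ} (h : y ∈ unstab f x e')
    (hk : ∀ k ≤ n, dist ((⇑f)^[k] x) ((⇑f)^[k] y) ≤ e') :
    dist x y ≤ lam ^ n * e' := by
  simpa using unstab_decay hS h hk (Nat.zero_le n)

/-- unstable back-shift -/
theorem unstab_symm_iter {x y : X} {a : ℝ} (h : y ∈ unstab f x a) (i : ℕ) :
    (⇑f.symm)^[i] y ∈ unstab f ((⇑f.symm)^[i] x) a := by
  intro n
  rw [← Function.iterate_add_apply, ← Function.iterate_add_apply]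
  exact h _

theorem stab_iter {x y : X} {a : ℝ} (h : y ∈ stab f x a) (i : ℕ) :
    (⇑f)^[i] y ∈ stab f ((⇑f)^[i] x) a := unstab_symm_iter (f := f.symm) h i

end
section
variable {f : X ≃ₜ X} {e e' lam : ℝ}

theorem clopen_piece (x0 : X) {a : ℝ} (ha : 0 < a) (htd : IsTotallyDisconnected (stab f x0 a))
    {r : ℝ} (hr : 0 < r) :
    ∃ S : Set X, x0 ∈ S ∧ (∀ s ∈ S, dist s x0 < r) ∧
      ∃ τ > 0, ∀ s ∈ S, ∀ s' ∈ stab f x0 a, dist s s' < τ → s' ∈ S := by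
  have hcl : IsClosed (stab f x0 a) :=
    (isClosed_stab f a).preimage (f := fun p : X => (x0, p)) (by fun_prop)
  have : CompactSpace (stab f x0 a) := isCompact_iff_compactSpace.1 hcl.isCompact
  have : TotallyDisconnectedSpace (stab f x0 a) := totallyDisconnectedSpace_subtype_iff.2 htd
  let p0 : stab f x0 a := ⟨x0, stab_self f x0 ha.le⟩
  obtain ⟨V, hV, hp0, hVU⟩ := compact_exists_isClopen_in_isOpen
    (Metric.isOpen_ball (x := p0) (ε := r)) (Metric.mem_ball_self hr)
  obtain ⟨τ, hτ, hτV⟩ := hV.isClosed.isCompact.exists_thickening_subset_open hV.isOpen subset_rfl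
  refine ⟨Subtype.val '' V, ⟨p0, hp0, rfl⟩, ?_, τ, hτ, ?_⟩
  · rintro _ ⟨s, hs, rfl⟩
    exact hVU hs
  · rintro _ ⟨s, hs, rfl⟩ s' hs' hd
    refine ⟨⟨s', hs'⟩, hτV ?_, rfl⟩
    rw [Metric.mem_thickening_iff]
    exact ⟨s, hs, by rw [dist_comm]; exact hd⟩

theorem bump (hS : isSmale f e e' lam)
    (htd : ∀ (x : X) (ε : ℝ), 0 < ε → ε ≤ e → IsTotallyDisconnected (stab f x ε))
    {ε : ℝ} (hε : 0 < ε) (x0 : X) :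
    ∃ φ : X → ℝ, 0 < φ x0 ∧ (∀ x, 0 ≤ φ x) ∧ (∀ x, 0 < φ x → dist x x0 ≤ ε) ∧
      (∃ η > 0, ∀ x y, y ∈ stab f x η → φ y = φ x) ∧
      (∃ ε0 > 0, ∀ (n : ℕ) (x y : X), y ∈ unstab f x ε0 →
        (∀ k ≤ n, dist ((⇑f)^[k] x) ((⇑f)^[k] y) ≤ ε0) → |φ x - φ y| ≤ lam ^ n * e') := by
  classical
  have he := hS.1
  have he' := hS.2.1
  obtain ⟨a, ha, hae, hae'⟩ : ∃ a > 0, a ≤ e ∧ 4 * a ≤ e' :=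
    ⟨min e (e' / 4), lt_min he (by linarith), min_le_left _ _,
      by linarith [min_le_right e (e' / 4)]⟩
  obtain ⟨ρ1, hρ1, hb1⟩ := brkt hS ha
  obtain ⟨ρ, hρ, hρρ1, hρε⟩ : ∃ ρ > 0, ρ ≤ ρ1 ∧ ρ ≤ ε :=
    ⟨min ρ1 ε, lt_min hρ1 hε, min_le_left _ _, min_le_right _ _⟩
  obtain ⟨b, hb, hba, hbρ⟩ : ∃ b > 0, b ≤ a ∧ 4 * b ≤ ρ :=
    ⟨min a (ρ / 4), lt_min ha (by linarith), min_le_left _ _,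
      by linarith [min_le_right a (ρ / 4)]⟩
  obtain ⟨ρ2, hρ2, hb2⟩ := brkt hS hb
  obtain ⟨r, hr, hrρ2, hrρ⟩ : ∃ r > 0, 2 * r ≤ ρ2 ∧ 4 * r ≤ ρ :=
    ⟨min (ρ2 / 2) (ρ / 4), lt_min (by linarith) (by linarith),
      by linarith [min_le_left (ρ2 / 2) (ρ / 4)],
      by linarith [min_le_right (ρ2 / 2) (ρ / 4)]⟩
  obtain ⟨S, hx0S, hSr, τ, hτ, hSτ⟩ := clopen_piece x0 ha (htd x0 a ha hae) hr
  have hu : ∀ x, ∃ u, dist x x0 ≤ ρ → u ∈ stab f x a ∧ u ∈ unstab f x0 a := by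
    intro x
    by_cases h : dist x x0 ≤ ρ
    · obtain ⟨u, hu⟩ := hb1 x x0 (h.trans hρρ1)
      exact ⟨u, fun _ => hu⟩
    · exact ⟨x, fun h' => absurd h' h⟩
  have hs : ∀ x, ∃ s, dist x x0 ≤ ρ → s ∈ stab f x0 a ∧ s ∈ unstab f x a := by
    intro x
    by_cases h : dist x x0 ≤ ρ
    · obtain ⟨u, hu⟩ := hb1 x0 x (by rw [dist_comm]; exact h.trans hρρ1)
      exact ⟨u, fun _ => hu⟩
    · exact ⟨x, fun h' => absurd h' h⟩
  choose u hu using hu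
  choose s hs using hs
  obtain ⟨η1, hη1, hsc⟩ := s_cont hS (a := a) (by linarith) x0 hτ
  let φ : X → ℝ := fun x =>
    if dist x x0 ≤ ρ ∧ s x ∈ S then max 0 (r - dist (u x) x0) else 0
  have hφ0 : ∀ x, 0 ≤ φ x := by
    intro x
    simp only [φ]
    split_ifs
    · exact le_max_left _ _
    · exact le_rfl
  have hφval : ∀ x, dist x x0 ≤ ρ → s x ∈ S → φ x = max 0 (r - dist (u x) x0) := by
    intro x h1 h2
    simp only [φ]
    rw [if_pos ⟨h1, h2⟩]
  have hφpos : ∀ x, 0 < φ x → dist x x0 ≤ ρ / 2 ∧ s x ∈ S := by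
    intro x hx
    have h1 : dist x x0 ≤ ρ ∧ s x ∈ S := by
      by_contra h
      simp only [φ] at hx
      rw [if_neg h] at hx
      exact lt_irrefl _ hx
    rw [hφval x h1.1 h1.2] at hx
    have h2 : dist (u x) x0 < r := by
      rcases lt_max_iff.1 hx with h | h
      · exact absurd h (lt_irrefl _)
      · linarith
    refine ⟨?_, h1.2⟩
    have h3 : dist (u x) (s x) ≤ ρ2 := by
      have := hSr _ h1.2
      have h4 := dist_triangle_right (u x) (s x) x0
      linarith
    obtain ⟨z, hz1, hz2⟩ := hb2 _ _ h3
    obtain ⟨hu1, hu2⟩ := hu x h1.1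
    obtain ⟨hs1, hs2⟩ := hs x h1.1
    have hzx : z = x := uniq hS (stab_mono (stab_trans hu1 hz1) (by linarith))
      (unstab_mono (unstab_trans hs2 hz2) (by linarith))
    have h5 := stab_dist hz1
    rw [hzx] at h5
    have h6 := dist_triangle_left x x0 (u x)
    linarith
  refine ⟨φ, ?_, hφ0, ?_, ?_, ?_⟩
  · have h0 : dist x0 x0 ≤ ρ := by simpa using hρ.le
    obtain ⟨hu1, hu2⟩ := hu x0 h0
    obtain ⟨hs1, hs2⟩ := hs x0 h0
    have h1 : u x0 = x0 := uniq hS (stab_mono hu1 (by linarith)) (unstab_mono hu2 (by linarith))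
    have h2 : s x0 = x0 := uniq hS (stab_mono hs1 (by linarith)) (unstab_mono hs2 (by linarith))
    rw [hφval x0 h0 (by rw [h2]; exact hx0S), h1]
    simpa using hr
  · intro x hx
    have := (hφpos x hx).1
    linarith
  · obtain ⟨η, hη, hηη1, hηρ, hηa⟩ : ∃ η > 0, η ≤ η1 ∧ 2 * η ≤ ρ ∧ η ≤ a :=
      ⟨min η1 (min (ρ / 2) a), lt_min hη1 (lt_min (by linarith) ha), min_le_left _ _,
        by linarith [(min_le_right η1 (min (ρ / 2) a)).trans (min_le_left _ _)],
        (min_le_right _ _).trans (min_le_right _ _)⟩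
    have main : ∀ x y, y ∈ stab f x η → 0 < φ x → φ y = φ x := by
      intro x y hxy hx
      obtain ⟨h1, h2⟩ := hφpos x hx
      have hd := stab_dist hxy
      have hx1 : dist x x0 ≤ ρ := by linarith
      have hy1 : dist y x0 ≤ ρ := by
        have := dist_triangle_left y x0 x
        linarith
      obtain ⟨hu1, hu2⟩ := hu x hx1
      obtain ⟨hs1, hs2⟩ := hs x hx1
      obtain ⟨hu3, hu4⟩ := hu y hy1
      obtain ⟨hs3, hs4⟩ := hs y hy1
      have hsy : s y ∈ S := hSτ _ h2 _ hs3 (hsc x y _ _ (hd.trans hηη1) hs1 hs3 hs2 hs4)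
      have huy : u y = u x := uniq hS
        (stab_mono (stab_trans (stab_symm hu1) (stab_trans hxy hu3)) (by linarith))
        (unstab_mono (unstab_trans (unstab_symm hu2) hu4) (by linarith))
      rw [hφval x hx1 h2, hφval y hy1 hsy, huy]
    refine ⟨η, hη, fun x y hxy => ?_⟩
    rcases (hφ0 x).lt_or_eq with h | h
    · exact main x y hxy h
    · rcases (hφ0 y).lt_or_eq with h' | h'
      · exact (main y x (stab_symm hxy) h').symm
      · rw [← h, ← h']
  · obtain ⟨ε0, hε0, hεa, hερ⟩ : ∃ ε0 > 0, ε0 ≤ a ∧ 2 * ε0 ≤ ρ :=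
      ⟨min a (ρ / 2), lt_min ha (by linarith), min_le_left _ _,
        by linarith [min_le_right a (ρ / 2)]⟩
    have main : ∀ (n : ℕ) (x y : X), y ∈ unstab f x ε0 →
        (∀ k ≤ n, dist ((⇑f)^[k] x) ((⇑f)^[k] y) ≤ ε0) → 0 < φ x →
        |φ x - φ y| ≤ lam ^ n * e' := by
      intro n x y hxy hk hx
      obtain ⟨h1, h2⟩ := hφpos x hx
      have hd := unstab_dist hxy
      have hx1 : dist x x0 ≤ ρ := by linarith
      have hy1 : dist y x0 ≤ ρ := by
        have := dist_triangle_left y x0 x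
        linarith
      obtain ⟨hu1, hu2⟩ := hu x hx1
      obtain ⟨hs1, hs2⟩ := hs x hx1
      obtain ⟨hu3, hu4⟩ := hu y hy1
      obtain ⟨hs3, hs4⟩ := hs y hy1
      have hsy : s y = s x := uniq hS
        (stab_mono (stab_trans (stab_symm hs1) hs3) (by linarith))
        (unstab_mono (unstab_trans (unstab_symm hs2) (unstab_trans hxy hs4)) (by linarith))
      have hdu : dist (u x) (u y) ≤ lam ^ n * e' := by
        refine unstab_decay0 hS (unstab_mono (unstab_trans (unstab_symm hu2) hu4)
          (by linarith)) fun k hkn => ?_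
        have t1 := stab_symm hu1 k
        have t2 := hk k hkn
        have t3 := hu3 k
        have t4 := dist_triangle4 ((⇑f)^[k] (u x)) ((⇑f)^[k] x) ((⇑f)^[k] y) ((⇑f)^[k] (u y))
        linarith
      rw [hφval x hx1 h2, hφval y hy1 (by rw [hsy]; exact h2)]
      refine (abs_max_sub_max_le_max _ _ _ _).trans (max_le ?_ ?_)
      · simpa using dist_nonneg.trans hdu
      · refine le_trans ?_ hdu
        have := abs_dist_sub_le (u y) (u x) x0
        rw [dist_comm (u x) (u y)]
        calc _ = |dist (u y) x0 - dist (u x) x0| := by congr 1; ring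
          _ ≤ _ := this
    refine ⟨ε0, hε0, fun n x y hxy hk => ?_⟩
    rcases (hφ0 x).lt_or_eq with h | h
    · exact main n x y hxy hk h
    · rcases (hφ0 y).lt_or_eq with h' | h'
      · rw [abs_sub_comm]
        exact main n y x (unstab_symm hxy) (fun k hkn => by rw [dist_comm]; exact hk k hkn) h'
      · rw [← h, ← h']
        simpa using mul_nonneg (pow_nonneg hS.2.2.1.le n) he'.le

/-- continuity from the stable / unstable regularity -/
theorem bump_cont (hS : isSmale f e e' lam) {φ : X → ℝ}
    (h1 : ∃ η > 0, ∀ x y, y ∈ stab f x η → φ y = φ x)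
    (h2 : ∃ ε0 > 0, ∀ (n : ℕ) (x y : X), y ∈ unstab f x ε0 →
        (∀ k ≤ n, dist ((⇑f)^[k] x) ((⇑f)^[k] y) ≤ ε0) → |φ x - φ y| ≤ lam ^ n * e') :
    Continuous φ := by
  obtain ⟨η, hη, h1⟩ := h1
  obtain ⟨ε0, hε0, h2⟩ := h2
  rw [Metric.continuous_iff]
  intro x ε hε
  have hlim : Filter.Tendsto (fun n : ℕ => lam ^ n * e') Filter.atTop (𝓝 (0 * e')) :=
    (tendsto_pow_atTop_nhds_zero_of_lt_one hS.2.2.1.le hS.2.2.2.1).mul_const _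
  rw [zero_mul] at hlim
  obtain ⟨n, hn⟩ := (hlim.eventually (gt_mem_nhds hε)).exists
  -- a scale at which n iterates stay close
  have hscale : ∃ ζ > 0, ∀ k ≤ n, ∀ p q : X, dist p q ≤ ζ →
      dist ((⇑f)^[k] p) ((⇑f)^[k] q) ≤ ε0 := by
    have : ∀ᶠ ζ : ℝ in 𝓝[>] 0, ∀ k ∈ Finset.range (n + 1), ∀ p q : X, dist p q ≤ ζ →
        dist ((⇑f)^[k] p) ((⇑f)^[k] q) ≤ ε0 := by
      rw [Filter.eventually_all_finset]
      intro k _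
      have huc := CompactSpace.uniformContinuous_of_continuous (f.continuous.iterate k)
      obtain ⟨δ, hδ, hk⟩ := Metric.uniformContinuous_iff.1 huc ε0 hε0
      filter_upwards [Ioo_mem_nhdsGT hδ] with ζ hζ p q hpq
      exact (hk (hpq.trans_lt hζ.2)).le
    obtain ⟨ζ, hζ, hζ0⟩ := (this.and self_mem_nhdsWithin).exists
    exact ⟨ζ, hζ0, fun k hk => hζ k (Finset.mem_range.2 (by omega))⟩
  obtain ⟨ζ, hζ, hζk⟩ := hscale
  obtain ⟨δ, hδ, hb⟩ := brkt hS (ε := min (min η ζ) ε0) (lt_min (lt_min hη hζ) hε0)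
  refine ⟨δ, hδ, fun y hy => ?_⟩
  obtain ⟨w, hw1, hw2⟩ := hb x y (by rw [dist_comm]; exact hy.le)
  have e1 : φ w = φ x :=
    h1 x w (stab_mono hw1 ((min_le_left _ _).trans (min_le_left _ _)))
  have e2 := h2 n y w (unstab_mono hw2 (min_le_right _ _)) (fun k hk => hζk k hk _ _
    ((unstab_dist hw2).trans ((min_le_left _ _).trans (min_le_right _ _))))
  rw [e1] at e2
  rw [Real.dist_eq]
  exact e2.trans_lt hn

/-- The map `Φ` -/
theorem exists_Phi (hS : isSmale f e e' lam)
    (htd : ∀ (x : X) (ε : ℝ), 0 < ε → ε ≤ e → IsTotallyDisconnected (stab f x ε))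
    {ε : ℝ} (hε : 0 < ε) :
    ∃ (I : Finset X) (Φ : X → (↥I → ℝ)), Continuous Φ ∧
      (∃ κ > 0, ∀ x y, dist (Φ x) (Φ y) < κ → dist x y ≤ ε) ∧
      (∃ η > 0, ∀ x y, y ∈ stab f x η → Φ y = Φ x) ∧
      (∃ ε0 > 0, ∀ (n : ℕ) (x y : X), y ∈ unstab f x ε0 →
        (∀ k ≤ n, dist ((⇑f)^[k] x) ((⇑f)^[k] y) ≤ ε0) →
          dist (Φ x) (Φ y) ≤ lam ^ n * e') := by
  choose φ hφ0 hφnn hφε hφs hφu using bump hS htd (half_pos hε)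
  have hcont : ∀ i, Continuous (φ i) := fun i => bump_cont hS (hφs i) (hφu i)
  obtain ⟨t, ht⟩ := isCompact_univ.elim_finite_subcover (fun i : X => {x | 0 < φ i x})
    (fun i => isOpen_lt continuous_const (hcont i))
    (fun x _ => Set.mem_iUnion.2 ⟨x, hφ0 x⟩)
  let Φ : X → (↥t → ℝ) := fun x i => φ i x
  have hΦ : Continuous Φ := continuous_pi fun i => hcont i
  refine ⟨t, Φ, hΦ, ?_, ?_, ?_⟩
  · have : ∃ κ > 0, ∀ x, κ ≤ ‖Φ x‖ := by
      rcases isEmpty_or_nonempty X with h | h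
      · exact ⟨1, one_pos, fun x => (h.false x).elim⟩
      obtain ⟨x, -, hmin⟩ := isCompact_univ.exists_isMinOn (Set.univ_nonempty (α := X))
        (f := fun x => ‖Φ x‖) (by fun_prop)
      refine ⟨‖Φ x‖, ?_, fun y => hmin (Set.mem_univ y)⟩
      refine norm_pos_iff.2 ?_
      intro h0
      obtain ⟨i, hi, hix⟩ := Set.mem_iUnion₂.1 (ht (Set.mem_univ x))
      have := congrFun h0 ⟨i, hi⟩
      simp only [Φ, Pi.zero_apply] at this
      have hix' : 0 < φ i x := hix
      linarith
    obtain ⟨κ, hκ, hk⟩ := this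
    refine ⟨κ, hκ, fun x y hxy => ?_⟩
    have : ∃ i, κ ≤ φ (i : ↥t) x := by
      by_contra hcon
      push Not at hcon
      have : ‖Φ x‖ < κ := by
        rw [pi_norm_lt_iff hκ]
        intro i
        rw [Real.norm_eq_abs, abs_of_nonneg (hφnn _ _)]
        exact hcon i
      linarith [hk x]
    obtain ⟨i, hi⟩ := this
    have h1 := (dist_le_pi_dist (Φ x) (Φ y) i).trans_lt hxy
    rw [Real.dist_eq] at h1
    have h2 := (abs_lt.1 h1).2
    simp only [Φ] at h2
    have h3 := hφε i x (by linarith)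
    have h4 := hφε i y (by linarith)
    have := dist_triangle_right x y i
    linarith
  · have : ∀ᶠ η : ℝ in 𝓝[>] 0, ∀ i : ↥t, ∀ x y, y ∈ stab f x η → φ i y = φ i x := by
      rw [Filter.eventually_all]
      intro i
      obtain ⟨η, hη, h⟩ := hφs i
      filter_upwards [Ioo_mem_nhdsGT hη] with ζ hζ x y hxy
      exact h x y (stab_mono hxy hζ.2.le)
    obtain ⟨η, hη, hη0⟩ := (this.and self_mem_nhdsWithin).exists
    exact ⟨η, hη0, fun x y hxy => funext fun i => hη i x y hxy⟩
  · have : ∀ᶠ ε0 : ℝ in 𝓝[>] 0, ∀ i : ↥t, ∀ (n : ℕ) (x y : X), y ∈ unstab f x ε0 →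
        (∀ k ≤ n, dist ((⇑f)^[k] x) ((⇑f)^[k] y) ≤ ε0) → |φ i x - φ i y| ≤ lam ^ n * e' := by
      rw [Filter.eventually_all]
      intro i
      obtain ⟨η, hη, h⟩ := hφu i
      filter_upwards [Ioo_mem_nhdsGT hη] with ζ hζ n x y hxy hk
      exact h n x y (unstab_mono hxy hζ.2.le) (fun k hkn => (hk k hkn).trans hζ.2.le)
    obtain ⟨η, hη, hη0⟩ := (this.and self_mem_nhdsWithin).exists
    refine ⟨η, hη0, fun n x y hxy hk => ?_⟩
    rw [dist_pi_le_iff (mul_nonneg (pow_nonneg hS.2.2.1.le n) hS.2.1.le)]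
    intro i
    rw [Real.dist_eq]
    exact hη i n x y hxy hk

end
section quot
open scoped BoundedContinuousFunction

theorem exists_quot {X E : Type u} [MetricSpace X] [CompactSpace X] [NormedAddCommGroup E]
    [NormedSpace ℝ E] (f : X ≃ₜ X) {θ : ℝ} (hθ0 : 0 < θ) (hθ1 : θ < 1) {Φ : X → E}
    (hΦ : Continuous Φ) :
    ∃ (Y : Type u) (_ : MetricSpace Y) (q : X → Y), Continuous q ∧ Function.Surjective q ∧
      (∀ x y (k : ℕ), θ ^ k * dist (Φ ((⇑f)^[k] x)) (Φ ((⇑f)^[k] y)) ≤ dist (q x) (q y)) ∧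
      (∀ x y (M : ℝ), 0 ≤ M →
        (∀ k : ℕ, θ ^ k * dist (Φ ((⇑f)^[k] x)) (Φ ((⇑f)^[k] y)) ≤ M) →
          dist (q x) (q y) ≤ M) := by
  obtain ⟨M, hM⟩ : ∃ M, ∀ x, ‖Φ x‖ ≤ M := by
    obtain ⟨M, hM⟩ := isCompact_univ.exists_bound_of_continuousOn hΦ.continuousOn
    exact ⟨M, fun x => hM x (Set.mem_univ x)⟩
  let G : X → (ℕ →ᵇ E) := fun x =>
    BoundedContinuousFunction.ofNormedAddCommGroup (fun k => θ ^ k • Φ ((⇑f)^[k] x))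
      continuous_of_discreteTopology M (fun k => by
        rw [norm_smul, Real.norm_eq_abs, abs_of_pos (pow_pos hθ0 k)]
        exact (mul_le_of_le_one_left (norm_nonneg _) (pow_le_one₀ hθ0.le hθ1.le)).trans (hM _))
  have hG : ∀ x y k, dist (G x k) (G y k) =
      θ ^ k * dist (Φ ((⇑f)^[k] x)) (Φ ((⇑f)^[k] y)) := by
    intro x y k
    change dist (θ ^ k • Φ ((⇑f)^[k] x)) (θ ^ k • Φ ((⇑f)^[k] y)) = _
    rw [dist_smul₀, Real.norm_eq_abs, abs_of_pos (pow_pos hθ0 k)]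
  have hGc : Continuous G := by
    rw [Metric.continuous_iff']
    intro x ε hε
    have hlim : Filter.Tendsto (fun n : ℕ => θ ^ n * (M + M)) Filter.atTop (𝓝 (0 * (M + M))) :=
      (tendsto_pow_atTop_nhds_zero_of_lt_one hθ0.le hθ1).mul_const _
    rw [zero_mul] at hlim
    obtain ⟨N, hN⟩ := (hlim.eventually (gt_mem_nhds (half_pos hε))).exists
    have hev : ∀ᶠ y in 𝓝 x, ∀ k ∈ Finset.range N,
        dist (Φ ((⇑f)^[k] y)) (Φ ((⇑f)^[k] x)) < ε / 2 := by
      rw [Filter.eventually_all_finset]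
      intro k _
      exact Metric.continuous_iff'.1 (hΦ.comp (f.continuous.iterate k)) x _ (half_pos hε)
    filter_upwards [hev] with y hy
    refine lt_of_le_of_lt ((BoundedContinuousFunction.dist_le (half_pos hε).le).2 fun k => ?_)
      (half_lt_self hε)
    rw [hG]
    rcases lt_or_ge k N with hk | hk
    · exact (mul_le_of_le_one_left dist_nonneg (pow_le_one₀ hθ0.le hθ1.le)).trans
        (hy k (Finset.mem_range.2 hk)).le
    · refine le_trans ?_ hN.le
      have h1 : dist (Φ ((⇑f)^[k] y)) (Φ ((⇑f)^[k] x)) ≤ M + M :=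
        (dist_le_norm_add_norm _ _).trans (add_le_add (hM _) (hM _))
      exact mul_le_mul (pow_le_pow_of_le_one hθ0.le hθ1.le hk) h1 dist_nonneg
        (pow_nonneg hθ0.le _)
  refine ⟨Set.range G, inferInstance, Set.rangeFactorization G, hGc.subtype_mk _,
    Set.rangeFactorization_surjective, ?_, ?_⟩
  · intro x y k
    rw [← hG]
    exact BoundedContinuousFunction.dist_coe_le_dist k
  · intro x y M hM h
    refine (BoundedContinuousFunction.dist_le hM).2 fun k => ?_
    exact (hG x y k).trans_le (h k)

end quot

section core
variable {Y E : Type*} [MetricSpace Y] [MetricSpace E]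
variable {f : X ≃ₜ X} {e e' lam : ℝ}

theorem iter_symm_sub (f : X ≃ₜ X) (x : X) {m n : ℕ} (h : m ≤ n) :
    (⇑f)^[m] ((⇑f.symm)^[n] x) = (⇑f.symm)^[n - m] x := symm_iter_sub f.symm x h

theorem iter_symm_sub' (f : X ≃ₜ X) (x : X) {m n : ℕ} (h : n ≤ m) :
    (⇑f)^[m] ((⇑f.symm)^[n] x) = (⇑f)^[m - n] x := symm_iter_sub' f.symm x h

theorem core (hS : isSmale f e e' lam) {θ : ℝ} (hlθ : lam < θ) (hθ1 : θ < 1)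
    {Φ : X → E} {q : X → Y} (hq : Continuous q)
    (D1 : ∀ x y (k : ℕ), θ ^ k * dist (Φ ((⇑f)^[k] x)) (Φ ((⇑f)^[k] y)) ≤ dist (q x) (q y))
    (D2 : ∀ x y (M : ℝ), 0 ≤ M →
        (∀ k : ℕ, θ ^ k * dist (Φ ((⇑f)^[k] x)) (Φ ((⇑f)^[k] y)) ≤ M) →
          dist (q x) (q y) ≤ M)
    {a ε κ η ε0 : ℝ} (ha : 0 < a) (hae : 4 * a ≤ e') (hεa : ε ≤ a)
    (hb : ∀ x y : X, dist x y ≤ ε → ∃ z, z ∈ stab f x a ∧ z ∈ unstab f y a)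
    (hκ : 0 < κ) (hΦκ : ∀ x y, dist (Φ x) (Φ y) < κ → dist x y ≤ ε)
    (hη : 0 < η) (hΦη : ∀ x y, y ∈ stab f x η → Φ y = Φ x)
    (hε0 : 0 < ε0) (hΦu : ∀ (n : ℕ) (x y : X), y ∈ unstab f x ε0 →
        (∀ k ≤ n, dist ((⇑f)^[k] x) ((⇑f)^[k] y) ≤ ε0) →
          dist (Φ x) (Φ y) ≤ lam ^ n * e') :
    ∃ (K : ℕ) (β : ℝ), 1 ≤ K ∧ 0 < β ∧ ∀ p y, dist (q p) (q y) ≤ β →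
      ∃ w, (∀ k ≥ K, Φ ((⇑f)^[k] w) = Φ ((⇑f)^[k] y)) ∧
        ∀ i : ℕ, dist (Φ ((⇑f.symm)^[i] ((⇑f)^[2 * K] p)))
          (Φ ((⇑f.symm)^[i] ((⇑f)^[2 * K] w))) ≤
          θ ^ (3 * K) * dist (q ((⇑f)^[2 * K] p)) (q ((⇑f)^[2 * K] w)) := by
  have hl0 : 0 < lam := hS.2.2.1
  have hl1 : lam < 1 := hS.2.2.2.1
  have he' := hS.2.1
  have hθ0 : 0 < θ := hl0.trans hlθ
  have shift : ∀ x y (n : ℕ),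
      θ ^ n * dist (q ((⇑f)^[n] x)) (q ((⇑f)^[n] y)) ≤ dist (q x) (q y) := by
    intro x y n
    have hpos := pow_pos hθ0 n
    rw [mul_comm, ← le_div_iff₀ hpos]
    refine D2 _ _ _ (div_nonneg dist_nonneg hpos.le) fun k => ?_
    rw [le_div_iff₀ hpos, ← Function.iterate_add_apply, ← Function.iterate_add_apply]
    refine le_trans (le_of_eq ?_) (D1 x y (k + n))
    rw [pow_add]; ring
  obtain ⟨ε1, hε1, hε10, hε1a⟩ : ∃ ε1 > 0, ε1 ≤ ε0 ∧ ε1 ≤ a :=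
    ⟨min ε0 a, lt_min hε0 ha, min_le_left _ _, min_le_right _ _⟩
  have stabeq : ∀ x y, dist (q x) (q y) = 0 → y ∈ stab f x ε := by
    intro x y h k
    refine hΦκ _ _ ?_
    have h1 := D1 x y k
    rw [h] at h1
    have := pow_pos hθ0 k
    have h2 : dist (Φ ((⇑f)^[k] x)) (Φ ((⇑f)^[k] y)) ≤ 0 := by
      by_contra hcon
      push Not at hcon
      linarith [mul_pos this hcon]
    linarith
  have hc : ∃ c > 0, ∀ p w, w ∈ unstab f p ε1 → ε1 ≤ dist (f p) (f w) →
      c ≤ dist (q p) (q w) := by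
    let Z : Set (X × X) := {p | p.2 ∈ unstab f p.1 ε1} ∩ {p | ε1 ≤ dist (f p.1) (f p.2)}
    have hZ : IsClosed Z := (isClosed_unstab f ε1).inter
      (isClosed_le (by fun_prop) (by fun_prop))
    rcases Z.eq_empty_or_nonempty with h | h
    · refine ⟨1, one_pos, fun p w h1 h2 => ?_⟩
      have : (p, w) ∈ Z := ⟨h1, h2⟩
      rw [h] at this
      exact this.elim
    · obtain ⟨p, hp, hmin⟩ := hZ.isCompact.exists_isMinOn h
        (f := fun p : X × X => dist (q p.1) (q p.2)) (by fun_prop)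
      refine ⟨dist (q p.1) (q p.2), ?_, fun p' w h1 h2 => hmin (a := (p', w)) ⟨h1, h2⟩⟩
      refine lt_of_le_of_ne dist_nonneg fun h0 => ?_
      have h1 : p.2 ∈ unstab f p.1 ε1 := hp.1
      have h2 : ε1 ≤ dist (f p.1) (f p.2) := hp.2
      have := uniq hS (stab_mono (stabeq _ _ h0.symm) (by linarith))
        (unstab_mono h1 (by linarith))
      rw [this] at h2
      simp at h2
      linarith
  obtain ⟨c, hc0, hc⟩ := hc
  have hlim : ∀ C : ℝ, ∀ {μ : ℝ}, 0 ≤ μ → μ < 1 → ∀ {d : ℝ}, 0 < d →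
      ∃ N : ℕ, ∀ n ≥ N, μ ^ n * C ≤ d := by
    intro C μ h0 h1 d hd
    have hl : Filter.Tendsto (fun n : ℕ => μ ^ n * C) Filter.atTop (𝓝 (0 * C)) :=
      (tendsto_pow_atTop_nhds_zero_of_lt_one h0 h1).mul_const _
    rw [zero_mul] at hl
    obtain ⟨N, hN⟩ := Filter.eventually_atTop.1 (hl.eventually (gt_mem_nhds hd))
    exact ⟨N, fun n hn => (hN n hn).le⟩
  obtain ⟨K0, hK0⟩ := hlim a hl0.le hl1 hη
  obtain ⟨K, hK1, hKη⟩ : ∃ K, 1 ≤ K ∧ lam ^ K * a ≤ η :=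
    ⟨K0 + 1, by omega, hK0 _ (by omega)⟩
  obtain ⟨n1, hn1⟩ := hlim e' hl0.le hl1 hε1
  obtain ⟨n2, hn2⟩ := hlim e' (μ := lam / θ) (div_nonneg hl0.le hθ0.le)
    ((div_lt_one hθ0).2 hlθ) (d := θ ^ (3 * K) * c) (mul_pos (pow_pos hθ0 _) hc0)
  have hn2' : ∀ n ≥ n2, lam ^ n * e' ≤ θ ^ (3 * K) * (θ ^ n * c) := by
    intro n hn
    have := hn2 n hn
    rw [div_pow, div_mul_eq_mul_div, div_le_iff₀ (pow_pos hθ0 n)] at this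
    linarith
  set N := 2 * K + n1 + n2 with hN
  refine ⟨K, θ ^ N * (κ / 2), hK1, mul_pos (pow_pos hθ0 _) (half_pos hκ), fun p y hpy => ?_⟩
  have hclose : ∀ k ≤ N, dist ((⇑f)^[k] p) ((⇑f)^[k] y) ≤ ε := by
    intro k hk
    refine hΦκ _ _ ?_
    have h1 := (D1 p y k).trans hpy
    have h2 : θ ^ N * (κ / 2) ≤ θ ^ k * (κ / 2) :=
      mul_le_mul_of_nonneg_right (pow_le_pow_of_le_one hθ0.le hθ1.le hk) (half_pos hκ).le
    have := le_of_mul_le_mul_left (h1.trans h2) (pow_pos hθ0 k)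
    linarith
  obtain ⟨w, hw1, hw2⟩ := hb y p (by rw [dist_comm]; exact hclose 0 (Nat.zero_le _))
  refine ⟨w, ?_, ?_⟩
  · have hs : (⇑f)^[K] w ∈ stab f ((⇑f)^[K] y) η := by
      have h0 : w ∈ stab f y e' := stab_mono hw1 (by linarith)
      refine stab_small hS (stab_iter h0 K) ((contr_s hS h0 K).trans (le_trans ?_ hKη))
      exact mul_le_mul_of_nonneg_left (stab_dist hw1) (pow_nonneg hl0.le _)
    intro k hk
    obtain ⟨j, rfl⟩ := Nat.exists_eq_add_of_le hk
    rw [Nat.add_comm K j, Function.iterate_add_apply, Function.iterate_add_apply]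
    exact hΦη _ _ (stab_iter hs j)
  have hwk : ∀ k ≤ N, dist ((⇑f)^[k] p) ((⇑f)^[k] w) ≤ e' := by
    intro k hk
    have h1 := hclose k hk
    have h2 := hw1 k
    have := dist_triangle ((⇑f)^[k] p) ((⇑f)^[k] y) ((⇑f)^[k] w)
    linarith
  have hw3 : w ∈ unstab f p e' := unstab_mono hw2 (by linarith)
  have hdec : ∀ k ≤ 2 * K + n2, dist ((⇑f)^[k] p) ((⇑f)^[k] w) ≤ ε1 := by
    intro k hk
    exact (unstab_decay hS hw3 hwk (k := k) (by omega)).trans (hn1 _ (by omega))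
  set P := (⇑f)^[2 * K] p with hP
  set W := (⇑f)^[2 * K] w with hW
  have hPW : W ∈ unstab f P ε1 :=
    unstab_small hS (unstab_shift hw3 fun k hk => hwk k (by omega)) (hdec _ (by omega))
  have hPWk : ∀ k ≤ n2, dist ((⇑f)^[k] P) ((⇑f)^[k] W) ≤ ε1 := by
    intro k hk
    rw [hP, hW, ← Function.iterate_add_apply, ← Function.iterate_add_apply]
    exact hdec _ (by omega)
  by_cases hPWe : W = P
  · intro i
    rw [hPWe]
    simp
  have hex : ∃ m : ℕ, ε1 < dist ((⇑f)^[m] P) ((⇑f)^[m] W) := by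
    by_contra hcon
    push Not at hcon
    exact hPWe (uniq hS (stab_mono (a := ε1) hcon (by linarith))
      (unstab_mono hPW (by linarith)))
  obtain ⟨n, hnn2, hnk, hnc⟩ : ∃ n ≥ n2, (∀ k ≤ n, dist ((⇑f)^[k] P) ((⇑f)^[k] W) ≤ ε1) ∧
      ε1 < dist ((⇑f)^[n + 1] P) ((⇑f)^[n + 1] W) := by
    classical
    have h1 := Nat.find_spec hex
    have h2 : ∀ k < Nat.find hex, dist ((⇑f)^[k] P) ((⇑f)^[k] W) ≤ ε1 := fun k hk =>
      not_lt.1 (Nat.find_min hex hk)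
    have h3 : n2 < Nat.find hex := by
      by_contra hcon
      have := hPWk _ (not_lt.1 hcon)
      linarith
    refine ⟨Nat.find hex - 1, by omega, fun k hk => h2 k (by omega), ?_⟩
    rw [Nat.sub_add_cancel (by omega)]
    exact h1
  have hcn : θ ^ n * c ≤ dist (q P) (q W) := by
    refine le_trans (mul_le_mul_of_nonneg_left ?_ (pow_nonneg hθ0.le n)) (shift P W n)
    refine hc _ _ (unstab_shift hPW hnk) ?_
    rw [Function.iterate_succ_apply', Function.iterate_succ_apply'] at hnc
    exact hnc.le
  intro i
  refine (hΦu n _ _ (unstab_symm_iter (unstab_mono hPW hε10) i) ?_).trans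
    ((hn2' n hnn2).trans (mul_le_mul_of_nonneg_left hcn (pow_nonneg hθ0.le _)))
  intro k hk
  rcases le_total k i with hki | hki
  · rw [iter_symm_sub f P hki, iter_symm_sub f W hki]
    exact (hPW _).trans hε10
  · rw [iter_symm_sub' f P hki, iter_symm_sub' f W hki]
    exact (hnk _ (by omega)).trans hε10

end core

section final

theorem final (X : Type u) [MetricSpace X] [CompactSpace X] (f : X ≃ₜ X)
    (e e' lam : ℝ) (hS : isSmale f e e' lam)
    (htd : ∀ (x : X) (ε : ℝ), 0 < ε → ε ≤ e → IsTotallyDisconnected (stab f x ε)) :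
    ∃ (Y : Type u) (mY : MetricSpace Y) (α : Y → Y), @conjToInvLim X _ f Y mY α := by
  have hl0 : 0 < lam := hS.2.2.1
  have hl1 : lam < 1 := hS.2.2.2.1
  have he' := hS.2.1
  obtain ⟨a, ha, hae⟩ : ∃ a > 0, 4 * a ≤ e' := ⟨e' / 4, by linarith, by linarith⟩
  obtain ⟨ρ, hρ, hb⟩ := brkt hS ha
  obtain ⟨ε, hε, hερ, hεa⟩ : ∃ ε > 0, ε ≤ ρ ∧ ε ≤ a :=
    ⟨min ρ a, lt_min hρ ha, min_le_left _ _, min_le_right _ _⟩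
  obtain ⟨I, Φ, hΦ, ⟨κ, hκ, hΦκ⟩, ⟨η, hη, hΦη⟩, ⟨ε0, hε0, hΦu⟩⟩ := exists_Phi hS htd hε
  obtain ⟨θ, hlθ, hθ1⟩ : ∃ θ, lam < θ ∧ θ < 1 := exists_between hl1
  have hθ0 : 0 < θ := hl0.trans hlθ
  obtain ⟨Y, mY, q, hq, hqs, D1, D2⟩ := exists_quot f hθ0 hθ1 hΦ
  obtain ⟨K, β, hK, hβ, hcore⟩ := core hS hlθ hθ1 hq D1 D2 ha hae hεa
    (fun x y hxy => hb x y (hxy.trans hερ)) hκ hΦκ hη hΦη hε0 hΦu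
  have shift : ∀ x y (n : ℕ),
      θ ^ n * dist (q ((⇑f)^[n] x)) (q ((⇑f)^[n] y)) ≤ dist (q x) (q y) := by
    intro x y n
    have hpos := pow_pos hθ0 n
    rw [mul_comm, ← le_div_iff₀ hpos]
    refine D2 _ _ _ (div_nonneg dist_nonneg hpos.le) fun k => ?_
    rw [le_div_iff₀ hpos, ← Function.iterate_add_apply, ← Function.iterate_add_apply]
    refine le_trans (le_of_eq ?_) (D1 x y (k + n))
    rw [pow_add]; ring
  have hqeq : ∀ x y, (∀ k, Φ ((⇑f)^[k] x) = Φ ((⇑f)^[k] y)) → q x = q y := by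
    intro x y h
    refine dist_le_zero.1 (D2 _ _ _ le_rfl fun k => ?_)
    rw [h k]; simp
  have hqstab : ∀ x y, q x = q y → y ∈ stab f x ε := by
    intro x y h k
    refine hΦκ _ _ ?_
    have h1 := D1 x y k
    rw [h, dist_self] at h1
    have := pow_pos hθ0 k
    have h2 : dist (Φ ((⇑f)^[k] x)) (Φ ((⇑f)^[k] y)) ≤ 0 := by
      by_contra hcon
      push Not at hcon
      linarith [mul_pos this hcon]
    linarith
  -- the map
  let α : Y → Y := fun y => q (f (Function.surjInv hqs y))
  have hlip : ∀ x y, θ * dist (q (f x)) (q (f y)) ≤ dist (q x) (q y) := by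
    intro x y
    simpa using shift x y 1
  have hα : ∀ x, α (q x) = q (f x) := by
    intro x
    have h1 := hlip (Function.surjInv hqs (q x)) x
    rw [Function.surjInv_eq hqs, dist_self] at h1
    refine dist_le_zero.1 ?_
    by_contra hcon
    push Not at hcon
    linarith [mul_pos hθ0 hcon]
  have hαn : ∀ n x, α^[n] (q x) = q ((⇑f)^[n] x) := by
    intro n x
    induction n with
    | zero => rfl
    | succ n ih => rw [Function.iterate_succ_apply', ih, hα, Function.iterate_succ_apply']
  have hαc : Continuous α := by
    have : LipschitzWith (Real.toNNReal θ⁻¹) α := by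
      refine LipschitzWith.of_dist_le_mul fun y y' => ?_
      obtain ⟨x, rfl⟩ := hqs y
      obtain ⟨x', rfl⟩ := hqs y'
      rw [hα, hα, Real.coe_toNNReal _ (inv_nonneg.2 hθ0.le), inv_mul_eq_div, le_div_iff₀ hθ0,
        mul_comm]
      exact hlip x x'
    exact this.continuous
  have hαs : Function.Surjective α := by
    intro y
    obtain ⟨x, rfl⟩ := hqs y
    exact ⟨q (f.symm x), by rw [hα]; simp⟩
  have hYc : CompactSpace Y := by
    refine ⟨?_⟩
    rw [← hqs.range_eq]
    exact isCompact_range hq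
  have hpow1 : ∀ n : ℕ, θ ^ n ≤ 1 := fun n => pow_le_one₀ hθ0.le hθ1.le
  have hpow0 : ∀ n : ℕ, 0 ≤ θ ^ n := fun n => pow_nonneg hθ0.le n
  refine ⟨Y, mY, α, hYc, hαc, hαs, β, θ, K, hβ, hK, hθ0, hθ1, ?_, ?_, ?_⟩
  · -- Axiom 1
    intro y1 y2 h12
    obtain ⟨x, rfl⟩ := hqs y1
    obtain ⟨y, rfl⟩ := hqs y2
    obtain ⟨w, hw1, hw2⟩ := hcore x y h12
    rw [hαn, hαn, hαn, hαn]
    have hWy : q ((⇑f)^[2 * K] w) = q ((⇑f)^[2 * K] y) := hqeq _ _ fun k => by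
      rw [← Function.iterate_add_apply, ← Function.iterate_add_apply]
      exact hw1 _ (by omega)
    rw [hWy] at hw2
    refine D2 _ _ _ (mul_nonneg (hpow0 _) dist_nonneg) fun k => ?_
    rcases lt_or_ge k K with hk | hk
    · have h1 := hw2 (K - k)
      rw [symm_iter_sub f x (by omega), symm_iter_sub f w (by omega),
        show 2 * K - (K - k) = k + K by omega, hw1 (k + K) (by omega),
        Function.iterate_add_apply, Function.iterate_add_apply] at h1
      refine (mul_le_of_le_one_left dist_nonneg (hpow1 k)).trans (h1.trans ?_)
      exact mul_le_mul_of_nonneg_right (pow_le_pow_of_le_one hθ0.le hθ1.le (by omega))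
        dist_nonneg
    · obtain ⟨j, rfl⟩ := Nat.exists_eq_add_of_le hk
      have h1 := D1 ((⇑f)^[2 * K] x) ((⇑f)^[2 * K] y) j
      rw [← Function.iterate_add_apply, ← Function.iterate_add_apply] at h1 ⊢
      rw [show K + j + K = j + 2 * K by ring, pow_add, mul_assoc]
      exact mul_le_mul_of_nonneg_left h1 (hpow0 _)
  · -- Axiom 2
    intro y1 r hr hrβ
    obtain ⟨x, rfl⟩ := hqs y1
    rintro _ ⟨y2, hy2, rfl⟩
    obtain ⟨y, rfl⟩ := hqs y2
    rw [hαn, Metric.mem_closedBall, dist_comm] at hy2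
    obtain ⟨w, hw1, hw2⟩ := hcore _ y (hy2.trans hrβ)
    have hWy : q ((⇑f)^[2 * K] w) = q ((⇑f)^[2 * K] y) := hqeq _ _ fun k => by
      rw [← Function.iterate_add_apply, ← Function.iterate_add_apply]
      exact hw1 _ (by omega)
    have hθK : θ ^ K * r ≤ θ * r := by
      refine mul_le_mul_of_nonneg_right ?_ hr.le
      simpa using pow_le_pow_of_le_one hθ0.le hθ1.le hK
    refine ⟨q ((⇑f.symm)^[K] w), ?_, ?_⟩
    · rw [Metric.mem_closedBall, dist_comm]
      refine D2 _ _ _ (mul_nonneg hθ0.le hr.le) fun k => ?_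
      refine le_trans ?_ hθK
      rcases lt_or_ge k (2 * K) with hk | hk
      · have h1 := hw2 (3 * K - k)
        have ex : (⇑f.symm)^[3 * K - k] ((⇑f)^[2 * K] ((⇑f)^[K] x)) = (⇑f)^[k] x := by
          rw [← Function.iterate_add_apply, symm_iter_sub f x (by omega)]
          congr 1; omega
        have ew : (⇑f.symm)^[3 * K - k] ((⇑f)^[2 * K] w) = (⇑f)^[k] ((⇑f.symm)^[K] w) := by
          rcases le_total k K with hkK | hkK
          · rw [iter_symm_sub f w hkK, symm_iter_sub' f w (by omega)]
            congr 1; omega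
          · rw [iter_symm_sub' f w hkK, symm_iter_sub f w (by omega)]
            congr 1; omega
        rw [ex, ew, hWy] at h1
        refine (mul_le_of_le_one_left dist_nonneg (hpow1 k)).trans (h1.trans ?_)
        have h2 := (shift ((⇑f)^[K] x) y (2 * K)).trans hy2
        calc _ = θ ^ K * (θ ^ (2 * K) * dist (q ((⇑f)^[2 * K] ((⇑f)^[K] x)))
              (q ((⇑f)^[2 * K] y))) := by ring
          _ ≤ _ := mul_le_mul_of_nonneg_left h2 (hpow0 _)
      · obtain ⟨j, rfl⟩ : ∃ j, k = K + j := Nat.exists_eq_add_of_le (by omega)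
        have h1 := (D1 ((⇑f)^[K] x) y j).trans hy2
        rw [iter_symm_sub' f w (by omega), Nat.add_sub_cancel_left, hw1 j (by omega), pow_add,
          mul_assoc, Nat.add_comm K j, Function.iterate_add_apply]
        exact mul_le_mul_of_nonneg_left h1 (hpow0 _)
    · rw [hαn, hαn, iter_symm_sub' f w (by omega), show 2 * K - K = K by omega]
      refine hqeq _ _ fun k => ?_
      rw [← Function.iterate_add_apply, ← Function.iterate_add_apply]
      exact hw1 _ (by omega)
  · -- the conjugacy
    have hstep : ∀ n x, α (q ((⇑f.symm)^[n + 1] x)) = q ((⇑f.symm)^[n] x) := by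
      intro n x
      rw [hα, Function.iterate_succ_apply']
      simp
    refine ⟨fun x => ⟨fun n => q ((⇑f.symm)^[n] x), fun n => (hstep n x).symm⟩, ?_, ?_⟩
    · rw [isHomeomorph_iff_continuous_bijective]
      refine ⟨?_, ?_, ?_⟩
      · refine Continuous.subtype_mk (continuous_pi fun n => ?_) _
        exact hq.comp (f.symm.continuous.iterate n)
      · intro x y hxy
        have h : ∀ n, q ((⇑f.symm)^[n] x) = q ((⇑f.symm)^[n] y) := fun n =>
          congrFun (congrArg Subtype.val hxy) n
        refine (uniq hS (stab_mono (hqstab x y (h 0)) (by linarith)) ?_).symm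
        intro n
        exact (stab_dist (hqstab _ _ (h n))).trans (by linarith)
      · intro y
        let C : ℕ → Set X := fun n => {x | q ((⇑f.symm)^[n] x) = y.1 n}
        have hCc : ∀ n, IsClosed (C n) := fun n =>
          isClosed_eq (hq.comp (f.symm.continuous.iterate n)) continuous_const
        have hne : (⋂ n, C n).Nonempty := by
          refine IsCompact.nonempty_iInter_of_sequence_nonempty_isCompact_isClosed C ?_ ?_
            (hCc 0).isCompact hCc
          · intro n x hx
            have hx' : q ((⇑f.symm)^[n + 1] x) = y.1 (n + 1) := hx
            change q ((⇑f.symm)^[n] x) = y.1 n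
            rw [← hstep, hx', y.2 n]
          · intro n
            obtain ⟨x, hx⟩ := hqs (y.1 n)
            refine ⟨(⇑f)^[n] x, ?_⟩
            change q ((⇑f.symm)^[n] ((⇑f)^[n] x)) = y.1 n
            rw [symm_iter_sub f x le_rfl, Nat.sub_self]
            exact hx
        obtain ⟨x, hx⟩ := hne
        exact ⟨x, Subtype.ext (funext fun n => Set.mem_iInter.1 hx n)⟩
    · intro x
      refine Subtype.ext (funext fun n => ?_)
      change q ((⇑f.symm)^[n] (f x)) = α (q ((⇑f.symm)^[n] x))
      rw [hα]
      have hcomm : Function.Commute (⇑f.symm) (⇑f) := fun z => by simp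
      exact congrArg q ((hcomm.iterate_left n) x)

end final

end Wieler

/-- **Theorem B.** An irreducible Smale space with totally disconnected local stable
sets is topologically conjugate to the stationary inverse limit of a system
satisfying Axioms 1 and 2. -/
theorem stmt3 (X : Type u) [MetricSpace X] [CompactSpace X] (f : X ≃ₜ X)
    (εX εX' lam : ℝ) (hS : isSmale f εX εX' lam)
    (hnw : ∀ (x : X) (U : Set X), IsOpen U → x ∈ U →
      ∃ n : ℕ, 1 ≤ n ∧ ((⇑f)^[n] '' U ∩ U).Nonempty)
    (hdense : ∃ x : X, Dense (Set.range fun n : ℤ => (f.toEquiv ^ n) x))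
    (htd : ∀ (x : X) (ε : ℝ), 0 < ε → ε ≤ εX → IsTotallyDisconnected (stab f x ε)) :
    ∃ (Y : Type u) (mY : MetricSpace Y) (α : Y → Y),
      @conjToInvLim X _ f Y mY α := by
  exact Wieler.final X f εX εX' lam hS htd
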